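/- The restriction of Φ^C to 𝒬_n^C takes values in 𝒫_{2n}^C, the map Φ̂^C takes values in 𝒬_n^C, these two maps are mutually inverse bijections, and both are order-preserving; hence Φ^C|_{𝒬_n^C} and Φ̂^C give an isomorphism of posets 𝒬_n^C ≅ 𝒫_{2n}^C. -/

import Mathlib

noncomputable section

/-- A partition, encoded as a weakly decreasing function `ℕ → ℕ` (0-indexed parts)
with finitely many nonzero values. -/
def IsPartitionFun (μ : ℕ → ℕ) : Prop :=
  (∀ i j : ℕ, i ≤ j → μ j ≤ μ i) ∧ ∃ N : ℕ, ∀ i : ℕ, N ≤ i → μ i = 0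

/-- The size `|μ|` of a partition. -/
def psum (μ : ℕ → ℕ) : ℕ := ∑ᶠ i, μ i

/-- The interleaved sequence `(2μ₁, 2ν₁, 2μ₂, 2ν₂, …)` (0-indexed). -/
def interleave (μ ν : ℕ → ℕ) : ℕ → ℕ :=
  fun k => if k % 2 = 0 then 2 * μ (k / 2) else 2 * ν (k / 2)

/-- `Φ^C(μ,ν)`: in the sequence `(2μ₁, 2ν₁, 2μ₂, 2ν₂, …)`, each adjacent pair `(2s, 2t)`
with `s < t` is replaced by `(s+t, s+t)`. -/
def PhiC (μ ν : ℕ → ℕ) : ℕ → ℕ := fun k =>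
  let c := interleave μ ν
  if c k < c (k + 1) then (c k + c (k + 1)) / 2
  else if 0 < k ∧ c (k - 1) < c k then (c (k - 1) + c k) / 2
  else c k

/-- Membership in `𝒫_{2n}^C`: a partition of `2n` in which every odd part occurs with even
multiplicity. -/
def InPC (n : ℕ) (l : ℕ → ℕ) : Prop :=
  IsPartitionFun l ∧ psum l = 2 * n ∧ ∀ m : ℕ, Odd m → Even {k : ℕ | l k = m}.ncard

/-- Membership in `𝒬_n^C`: a bipartition `(μ,ν)` of `n` with `μ_i ≥ ν_i - 1` and
`ν_i ≥ μ_{i+1} - 1` for all `i` (0-indexed, written additively to avoid truncated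
subtraction). -/
def InQnC (n : ℕ) (a : (ℕ → ℕ) × (ℕ → ℕ)) : Prop :=
  IsPartitionFun a.1 ∧ IsPartitionFun a.2 ∧ psum a.1 + psum a.2 = n ∧
  (∀ i : ℕ, a.2 i ≤ a.1 i + 1) ∧ (∀ i : ℕ, a.1 (i + 1) ≤ a.2 i + 1)

/-- The sequence `λ'` of the definition of `Φ̂^C`: every even part of `λ` is halved, and
every maximal run of equal odd parts `(2k+1, …, 2k+1)` is replaced by `(k, k+1, …, k, k+1)`.
Since `λ` is weakly decreasing, the run containing position `j` starts at position
`a = #{i : λ_i > λ_j}`, and position `j` receives `k` if `j - a` is even and `k+1`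
otherwise. -/
def hatSeq (l : ℕ → ℕ) : ℕ → ℕ := fun j =>
  if l j % 2 = 0 then l j / 2
  else if (j - {i : ℕ | l j < l i}.ncard) % 2 = 0 then l j / 2 else l j / 2 + 1

/-- `Φ̂^C(λ) = (μ, ν)` where `μ = (λ'₁, λ'₃, …)` and `ν = (λ'₂, λ'₄, …)` (0-indexed). -/
def PhiHat (l : ℕ → ℕ) : (ℕ → ℕ) × (ℕ → ℕ) :=
  (fun j => hatSeq l (2 * j), fun j => hatSeq l (2 * j + 1))

/-- The partial order on bipartitions (0-indexed parts). -/
def QnLE (a b : (ℕ → ℕ) × (ℕ → ℕ)) : Prop :=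
  ∀ j : ℕ,
    (∑ i ∈ Finset.range j, (a.1 i + a.2 i)) ≤ (∑ i ∈ Finset.range j, (b.1 i + b.2 i)) ∧
    a.1 j + (∑ i ∈ Finset.range j, (a.1 i + a.2 i)) ≤
      b.1 j + (∑ i ∈ Finset.range j, (b.1 i + b.2 i))

/-- The dominance order on partitions. -/
def DomLE (l m : ℕ → ℕ) : Prop :=
  ∀ j : ℕ, (∑ i ∈ Finset.range j, l i) ≤ ∑ i ∈ Finset.range j, m i

/-- The sequence `(μ₁, ν₁, μ₂, ν₂, …)` attached to a bipartition `(μ, ν)`. -/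
def weave (a : (ℕ → ℕ) × (ℕ → ℕ)) : ℕ → ℕ :=
  fun k => if k % 2 = 0 then a.1 (k / 2) else a.2 (k / 2)

/-- The conditions on a sequence `c` expressing that `c` is the weaving of an element
of `𝒬_n^C` for some `n`. -/
structure IsQuasiPartition (c : ℕ → ℕ) : Prop where
  add_two_le : ∀ k, c (k + 1 + 1) ≤ c k
  succ_le : ∀ k, c (k + 1) ≤ c k + 1
  eventually_zero : ∃ N, ∀ k, N ≤ k → c k = 0

theorem weave_even (a : (ℕ → ℕ) × (ℕ → ℕ)) (i : ℕ) : weave a (2 * i) = a.1 i := by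
  simp [weave]

theorem weave_odd (a : (ℕ → ℕ) × (ℕ → ℕ)) (i : ℕ) : weave a (2 * i + 1) = a.2 i := by
  have h1 : (2 * i + 1) % 2 = 1 := by omega
  have h2 : (2 * i + 1) / 2 = i := by omega
  simp [weave, h1, h2]

theorem weave_injective : Function.Injective weave := by
  intro a b h
  refine Prod.ext (funext fun i => ?_) (funext fun i => ?_)
  · rw [← weave_even a, h, weave_even]
  · rw [← weave_odd a, h, weave_odd]

theorem interleave_eq_weave (a : (ℕ → ℕ) × (ℕ → ℕ)) (k : ℕ) :
    interleave a.1 a.2 k = 2 * weave a k := by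
  unfold interleave weave
  split_ifs <;> rfl

theorem weave_PhiHat (l : ℕ → ℕ) : weave (PhiHat l) = hatSeq l := by
  funext k
  rcases Nat.even_or_odd' k with ⟨i, rfl | rfl⟩
  · rw [weave_even]; rfl
  · rw [weave_odd]; rfl

theorem sum_range_two_mul (a : (ℕ → ℕ) × (ℕ → ℕ)) (j : ℕ) :
    ∑ i ∈ Finset.range (2 * j), weave a i = ∑ i ∈ Finset.range j, (a.1 i + a.2 i) := by
  induction j with
  | zero => simp
  | succ j ih =>
    rw [mul_add, mul_one, Finset.sum_range_succ, Finset.sum_range_succ, Finset.sum_range_succ,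
      ih, weave_even, weave_odd, add_assoc]

theorem psum_eq_sum_range {f : ℕ → ℕ} {N : ℕ} (h : ∀ k, N ≤ k → f k = 0) :
    psum f = ∑ i ∈ Finset.range N, f i := by
  refine finsum_eq_sum_of_support_subset f fun k hk => ?_
  by_contra hc
  exact hk (h k (by simpa using hc))

theorem weave_eq_zero {a : (ℕ → ℕ) × (ℕ → ℕ)} {N : ℕ} (h1 : ∀ k, N ≤ k → a.1 k = 0)
    (h2 : ∀ k, N ≤ k → a.2 k = 0) (k : ℕ) (hk : 2 * N ≤ k) : weave a k = 0 := by
  unfold weave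
  split_ifs
  · exact h1 _ (by omega)
  · exact h2 _ (by omega)

theorem psum_weave {a : (ℕ → ℕ) × (ℕ → ℕ)} {N : ℕ} (h1 : ∀ k, N ≤ k → a.1 k = 0)
    (h2 : ∀ k, N ≤ k → a.2 k = 0) : psum (weave a) = psum a.1 + psum a.2 := by
  rw [psum_eq_sum_range (weave_eq_zero h1 h2), psum_eq_sum_range h1, psum_eq_sum_range h2,
    sum_range_two_mul, Finset.sum_add_distrib]

theorem inQnC_iff_weave (n : ℕ) (a : (ℕ → ℕ) × (ℕ → ℕ)) :
    InQnC n a ↔ IsQuasiPartition (weave a) ∧ psum (weave a) = n := by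
  constructor
  · rintro ⟨⟨hm, N, hN⟩, ⟨hv, M, hM⟩, hs, h1, h2⟩
    have hN' : ∀ k, max N M ≤ k → a.1 k = 0 := fun k hk => hN k (by omega)
    have hM' : ∀ k, max N M ≤ k → a.2 k = 0 := fun k hk => hM k (by omega)
    refine ⟨⟨fun k => ?_, fun k => ?_, _, weave_eq_zero hN' hM'⟩, by rw [psum_weave hN' hM', hs]⟩
    · rcases Nat.even_or_odd' k with ⟨i, rfl | rfl⟩
      · rw [show 2 * i + 1 + 1 = 2 * (i + 1) by ring, weave_even, weave_even]
        exact hm _ _ (by omega)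
      · rw [show 2 * i + 1 + 1 + 1 = 2 * (i + 1) + 1 by ring, weave_odd, weave_odd]
        exact hv _ _ (by omega)
    · rcases Nat.even_or_odd' k with ⟨i, rfl | rfl⟩
      · rw [weave_even, weave_odd]
        exact h1 i
      · rw [show 2 * i + 1 + 1 = 2 * (i + 1) by ring, weave_even, weave_odd]
        exact h2 i
  · rintro ⟨⟨h2, h1, N, hN⟩, hs⟩
    have hN' : ∀ k, N ≤ k → a.1 k = 0 := fun k hk => by
      rw [← weave_even]; exact hN _ (by omega)
    have hM' : ∀ k, N ≤ k → a.2 k = 0 := fun k hk => by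
      rw [← weave_odd]; exact hN _ (by omega)
    have hm : Antitone a.1 := antitone_nat_of_succ_le fun i => by
      rw [← weave_even, ← weave_even]; exact h2 (2 * i)
    have hv : Antitone a.2 := antitone_nat_of_succ_le fun i => by
      rw [← weave_odd, ← weave_odd]; exact h2 (2 * i + 1)
    refine ⟨⟨fun i j h => hm h, N, hN'⟩, ⟨fun i j h => hv h, N, hM'⟩, ?_, fun i => ?_, fun i => ?_⟩
    · rw [← psum_weave hN' hM', hs]
    · rw [← weave_even, ← weave_odd]; exact h1 (2 * i)
    · rw [← weave_even, ← weave_odd]; exact h1 (2 * i + 1)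

theorem qnLE_iff_weave (a b : (ℕ → ℕ) × (ℕ → ℕ)) :
    QnLE a b ↔ DomLE (weave a) (weave b) := by
  have hodd : ∀ (a : (ℕ → ℕ) × (ℕ → ℕ)) j, ∑ i ∈ Finset.range (2 * j + 1), weave a i =
      a.1 j + ∑ i ∈ Finset.range j, (a.1 i + a.2 i) := fun a j => by
    rw [Finset.sum_range_succ, sum_range_two_mul, weave_even, add_comm]
  constructor
  · intro h j
    rcases Nat.even_or_odd' j with ⟨i, rfl | rfl⟩
    · rw [sum_range_two_mul, sum_range_two_mul]; exact (h i).1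
    · rw [hodd, hodd]; exact (h i).2
  · intro h j
    refine ⟨?_, ?_⟩
    · rw [← sum_range_two_mul, ← sum_range_two_mul]; exact h _
    · rw [← hodd, ← hodd]; exact h _

/-- `PhiC` in terms of the weaving, for sequences in which each ascent is by one. -/
def collapse (c : ℕ → ℕ) (k : ℕ) : ℕ :=
  if c k < c (k + 1) then 2 * c k + 1
  else if 0 < k ∧ c (k - 1) < c k then 2 * c k - 1
  else 2 * c k

theorem PhiC_eq_collapse {a : (ℕ → ℕ) × (ℕ → ℕ)} (h : ∀ k, weave a (k + 1) ≤ weave a k + 1) :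
    PhiC a.1 a.2 = collapse (weave a) := by
  funext k
  simp only [PhiC, collapse, interleave_eq_weave]
  rcases k with _ | k
  · have := h 0
    simp only [zero_add] at *
    split_ifs <;> omega
  · have := h k
    have := h (k + 1)
    simp only [Nat.add_sub_cancel]
    split_ifs <;> omega

/-- Each ascent of `c` straddling position `j` adds one to the `j`-th partial sum. -/
theorem sum_range_succ_collapse {c : ℕ → ℕ} (hc : IsQuasiPartition c) (j : ℕ) :
    ∑ i ∈ Finset.range (j + 1), collapse c i =
      2 * ∑ i ∈ Finset.range (j + 1), c i + if c j < c (j + 1) then 1 else 0 := by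
  induction j with
  | zero => simp [collapse]; split_ifs <;> rfl
  | succ j ih =>
    rw [Finset.sum_range_succ, ih, Finset.sum_range_succ _ (j + 1)]
    have := hc.add_two_le j
    have := hc.succ_le j
    have := hc.succ_le (j + 1)
    simp only [collapse, Nat.add_sub_cancel, Nat.succ_pos, true_and]
    split_ifs <;> omega

theorem sum_range_collapse_div_two {c : ℕ → ℕ} (hc : IsQuasiPartition c) (j : ℕ) :
    (∑ i ∈ Finset.range j, collapse c i) / 2 = ∑ i ∈ Finset.range j, c i := by
  rcases j with _ | j
  · simp
  · rw [sum_range_succ_collapse hc]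
    split_ifs <;> omega

theorem collapse_succ_le {c : ℕ → ℕ} (hc : IsQuasiPartition c) (k : ℕ) :
    collapse c (k + 1) ≤ collapse c k := by
  have := hc.add_two_le k
  have := hc.succ_le k
  have := hc.succ_le (k + 1)
  simp only [collapse, Nat.add_sub_cancel, Nat.succ_pos, true_and]
  rcases k with _ | k
  · simp only [zero_add, lt_irrefl, false_and, if_false] at *
    split_ifs <;> omega
  · have := hc.add_two_le k
    have := hc.succ_le k
    simp only [Nat.add_sub_cancel, Nat.succ_pos, true_and] at *
    split_ifs <;> omega

theorem collapse_eq_zero {c : ℕ → ℕ} {N : ℕ} (hN : ∀ k, N ≤ k → c k = 0) (k : ℕ) (hk : N ≤ k) :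
    collapse c k = 0 := by
  simp [collapse, hN k hk, hN (k + 1) (by omega)]

theorem setOf_collapse_eq {c : ℕ → ℕ} (hc : IsQuasiPartition c) {m : ℕ} (hm : Odd m) :
    {k | collapse c k = m} = {k | c k < c (k + 1) ∧ collapse c k = m} ∪
      Nat.succ '' {k | c k < c (k + 1) ∧ collapse c k = m} := by
  obtain ⟨r, rfl⟩ := hm
  ext k
  simp only [Set.mem_union, Set.mem_ofPred_eq, Set.mem_image]
  constructor
  · intro h
    by_cases hk : c k < c (k + 1)
    · exact Or.inl ⟨hk, h⟩
    · right
      rcases k with _ | k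
      · simp only [collapse, lt_irrefl, false_and, if_false, if_neg hk] at h
        omega
      · simp only [collapse, Nat.add_sub_cancel, Nat.succ_pos, true_and, if_neg hk] at h
        have := hc.succ_le k
        split_ifs at h with h'
        · refine ⟨k, ⟨h', ?_⟩, rfl⟩
          simp only [collapse, if_pos h']
          omega
        · omega
  · rintro (⟨-, h⟩ | ⟨k, ⟨hk, h⟩, rfl⟩)
    · exact h
    · have := hc.add_two_le k
      have := hc.succ_le k
      simp only [collapse, if_pos hk] at h
      have hk' : ¬ c (k + 1) < c (k + 1 + 1) := by
        omega
      simp only [Nat.succ_eq_add_one, collapse, Nat.add_sub_cancel, Nat.succ_pos, true_and,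
        if_pos hk, if_neg hk']
      omega

theorem even_ncard_collapse_eq {c : ℕ → ℕ} (hc : IsQuasiPartition c) {m : ℕ} (hm : Odd m) :
    Even {k | collapse c k = m}.ncard := by
  obtain ⟨N, hN⟩ := hc.eventually_zero
  have hfin : {k | c k < c (k + 1) ∧ collapse c k = m}.Finite := by
    refine (Set.finite_lt_nat N).subset fun k hk => ?_
    by_contra h
    have h0 := hN (k + 1) (by simp only [Set.mem_ofPred_eq] at h; omega)
    have := hk.1
    omega
  rw [setOf_collapse_eq hc hm, Set.ncard_union_eq _ hfin (hfin.image _),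
    Set.ncard_image_of_injective _ Nat.succ_injective]
  · exact ⟨_, rfl⟩
  · rw [Set.disjoint_left]
    rintro _ ⟨h1, -⟩ ⟨k, ⟨h2, -⟩, rfl⟩
    have := hc.add_two_le k
    simp only [Nat.succ_eq_add_one] at h1
    omega

theorem inPC_collapse {c : ℕ → ℕ} (hc : IsQuasiPartition c) : InPC (psum c) (collapse c) := by
  obtain ⟨N, hN⟩ := hc.eventually_zero
  refine ⟨⟨fun i j h => antitone_nat_of_succ_le (collapse_succ_le hc) h, N, collapse_eq_zero hN⟩,
    ?_, fun m hm => even_ncard_collapse_eq hc hm⟩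
  have hN' : ∀ k, N + 1 ≤ k → c k = 0 := fun k hk => hN k (by omega)
  rw [psum_eq_sum_range hN', psum_eq_sum_range (collapse_eq_zero hN'),
    sum_range_succ_collapse hc, hN N le_rfl, hN (N + 1) (by omega)]
  simp

theorem domLE_collapse {c d : ℕ → ℕ} (hc : IsQuasiPartition c) (hd : IsQuasiPartition d)
    (h : DomLE c d) : DomLE (collapse c) (collapse d) := by
  intro j
  rcases j with _ | j
  · simp
  · rw [sum_range_succ_collapse hc, sum_range_succ_collapse hd]
    have h0 := h j
    have h1 := h (j + 1)
    have h2 := h (j + 2)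
    simp only [Finset.sum_range_succ] at h0 h1 h2 ⊢
    split_ifs <;> omega

/-- The parts of `l` exceeding a bound have even sum. -/
theorem even_sum_range_of_lt {n : ℕ} {l : ℕ → ℕ} (hl : InPC n l) {k : ℕ} (h : l (k + 1) < l k) :
    Even (∑ i ∈ Finset.range (k + 1), l i) := by
  obtain ⟨⟨hanti, -⟩, -, hodd⟩ := hl
  rw [← Finset.sum_fiberwise_of_maps_to
    (fun i hi => Finset.mem_image_of_mem l hi : ∀ i ∈ Finset.range (k + 1), l i ∈ _)]
  refine Finset.even_sum _ fun v hv => ?_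
  obtain ⟨j, hj, rfl⟩ := Finset.mem_image.1 hv
  rw [Finset.sum_congr rfl (fun i hi => (Finset.mem_filter.1 hi).2), Finset.sum_const, smul_eq_mul]
  rcases Nat.even_or_odd (l j) with he | ho
  · exact he.mul_left _
  · refine Even.mul_right ?_ _
    have hset : {i | l i = l j} = ↑((Finset.range (k + 1)).filter fun i => l i = l j) := by
      ext i
      simp only [Set.mem_ofPred_eq, Finset.coe_filter, Finset.mem_range] at *
      refine ⟨fun hi => ⟨?_, hi⟩, fun hi => hi.2⟩
      by_contra hc
      have := hanti (k + 1) i (by omega)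
      have := hanti j k (by omega)
      omega
    have := hodd _ ho
    rwa [hset, Set.ncard_coe_finset] at this

/-- The parity of the position inside a run of equal odd parts is the parity of the sum of the
preceding parts. -/
theorem sum_range_mod_two {n : ℕ} {l : ℕ → ℕ} (hl : InPC n l) {k : ℕ} (hk : Odd (l k)) :
    (∑ i ∈ Finset.range k, l i) % 2 = (k - {i | l k < l i}.ncard) % 2 := by
  induction k with
  | zero => simp
  | succ k ih =>
    rcases (hl.1.1 k (k + 1) (by omega)).lt_or_eq with h | h
    · have hset : {i | l (k + 1) < l i} = ↑(Finset.range (k + 1)) := by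
        ext i
        simp only [Set.mem_ofPred_eq, Finset.coe_range, Set.mem_Iio]
        constructor
        · intro hi
          by_contra hc
          have := hl.1.1 (k + 1) i (by omega)
          omega
        · intro hi
          exact h.trans_le (hl.1.1 i k (by omega))
      rw [hset, Set.ncard_coe_finset, Finset.card_range, Nat.sub_self]
      exact Nat.even_iff.1 (even_sum_range_of_lt hl h)
    · have hle : {i | l k < l i}.ncard ≤ k := by
        conv_rhs => rw [← Finset.card_range k, ← Set.ncard_coe_finset]
        refine Set.ncard_le_ncard (fun i (hi : l k < l i) => ?_) (Finset.finite_toSet _)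
        simp only [Finset.coe_range, Set.mem_Iio]
        by_contra hc
        have := hl.1.1 k i (by omega)
        omega
      rw [h] at hk ⊢
      have := ih hk
      have := Nat.odd_iff.1 hk
      rw [Finset.sum_range_succ]
      omega

theorem sum_range_hatSeq {n : ℕ} {l : ℕ → ℕ} (hl : InPC n l) (j : ℕ) :
    ∑ i ∈ Finset.range j, hatSeq l i = (∑ i ∈ Finset.range j, l i) / 2 := by
  induction j with
  | zero => simp
  | succ j ih =>
    rw [Finset.sum_range_succ, ih, Finset.sum_range_succ]
    unfold hatSeq
    rcases Nat.even_or_odd (l j) with h | h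
    · have := Nat.even_iff.1 h
      rw [if_pos this]
      omega
    · have h' := Nat.odd_iff.1 h
      rw [if_neg (by omega), ← sum_range_mod_two hl h]
      split_ifs <;> omega

theorem hatSeq_add {n : ℕ} {l : ℕ → ℕ} (hl : InPC n l) (k : ℕ) :
    (∑ i ∈ Finset.range k, l i) / 2 + hatSeq l k = (∑ i ∈ Finset.range k, l i + l k) / 2 := by
  rw [← Finset.sum_range_succ, ← sum_range_hatSeq hl, ← sum_range_hatSeq hl,
    Finset.sum_range_succ]

theorem hatSeq_eq_zero {l : ℕ → ℕ} {k : ℕ} (h : l k = 0) : hatSeq l k = 0 := by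
  simp [hatSeq, h]

theorem isQuasiPartition_hatSeq {n : ℕ} {l : ℕ → ℕ} (hl : InPC n l) :
    IsQuasiPartition (hatSeq l) := by
  refine ⟨fun k => ?_, fun k => ?_, ?_⟩
  · have h0 := hatSeq_add hl k
    have h1 := hatSeq_add hl (k + 1)
    have h2 := hatSeq_add hl (k + 1 + 1)
    simp only [Finset.sum_range_succ] at h1 h2
    have := hl.1.1 k (k + 1) (by omega)
    have := hl.1.1 (k + 1) (k + 1 + 1) (by omega)
    omega
  · have h0 := hatSeq_add hl k
    have h1 := hatSeq_add hl (k + 1)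
    simp only [Finset.sum_range_succ] at h1
    have := hl.1.1 k (k + 1) (by omega)
    omega
  · obtain ⟨N, hN⟩ := hl.1.2
    exact ⟨N, fun k hk => hatSeq_eq_zero (hN k hk)⟩

theorem psum_hatSeq {n : ℕ} {l : ℕ → ℕ} (hl : InPC n l) : psum (hatSeq l) = n := by
  obtain ⟨N, hN⟩ := hl.1.2
  have h := hl.2.1
  rw [psum_eq_sum_range hN] at h
  rw [psum_eq_sum_range fun k hk => hatSeq_eq_zero (hN k hk), sum_range_hatSeq hl, h]
  omega

theorem collapse_hatSeq {n : ℕ} {l : ℕ → ℕ} (hl : InPC n l) : collapse (hatSeq l) = l := by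
  have hpar : ∀ k, l (k + 1) < l k → (∑ i ∈ Finset.range k, l i + l k) % 2 = 0 := fun k h => by
    rw [← Finset.sum_range_succ]
    exact Nat.even_iff.1 (even_sum_range_of_lt hl h)
  funext k
  have a1 := hl.1.1 k (k + 1) (by omega)
  rcases k with _ | k
  · have h0 := hatSeq_add hl 0
    have h1 := hatSeq_add hl 1
    have p0 := hpar 0
    simp only [collapse, Finset.sum_range_succ, Finset.sum_range_zero, zero_add, lt_irrefl,
      false_and, if_false] at *
    split_ifs <;> omega
  · have h0 := hatSeq_add hl k
    have h1 := hatSeq_add hl (k + 1)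
    have h2 := hatSeq_add hl (k + 1 + 1)
    have p0 := hpar k
    have p1 := hpar (k + 1)
    have a0 := hl.1.1 k (k + 1) (by omega)
    simp only [collapse, Nat.add_sub_cancel, Nat.succ_pos, true_and, Finset.sum_range_succ] at *
    split_ifs <;> omega

theorem hatSeq_collapse {c : ℕ → ℕ} (hc : IsQuasiPartition c) : hatSeq (collapse c) = c := by
  have h : ∀ j, ∑ i ∈ Finset.range j, hatSeq (collapse c) i = ∑ i ∈ Finset.range j, c i :=
    fun j => by rw [sum_range_hatSeq (inPC_collapse hc), sum_range_collapse_div_two hc]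
  funext k
  have := h (k + 1)
  rw [Finset.sum_range_succ, Finset.sum_range_succ, h k] at this
  exact Nat.add_left_cancel this

theorem domLE_hatSeq {n n' : ℕ} {l m : ℕ → ℕ} (hl : InPC n l) (hm : InPC n' m) (h : DomLE l m) :
    DomLE (hatSeq l) (hatSeq m) := fun j => by
  rw [sum_range_hatSeq hl, sum_range_hatSeq hm]
  exact Nat.div_le_div_right (h j)

/-- `Φ^C` restricted to `𝒬_n^C` takes values in `𝒫_{2n}^C`, `Φ̂^C` takes
values in `𝒬_n^C`, the two maps are mutually inverse, and both are order-preserving;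
hence they give an isomorphism of posets `𝒬_n^C ≅ 𝒫_{2n}^C`. -/
theorem poset_isomorphism (n : ℕ) (hn : 1 ≤ n) :
    (∀ a : (ℕ → ℕ) × (ℕ → ℕ), InQnC n a → InPC n (PhiC a.1 a.2)) ∧
    (∀ l : ℕ → ℕ, InPC n l → InQnC n (PhiHat l)) ∧
    (∀ a : (ℕ → ℕ) × (ℕ → ℕ), InQnC n a → PhiHat (PhiC a.1 a.2) = a) ∧
    (∀ l : ℕ → ℕ, InPC n l → PhiC (PhiHat l).1 (PhiHat l).2 = l) ∧
    (∀ a b : (ℕ → ℕ) × (ℕ → ℕ), InQnC n a → InQnC n b → QnLE a b →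
      DomLE (PhiC a.1 a.2) (PhiC b.1 b.2)) ∧
    (∀ l m : ℕ → ℕ, InPC n l → InPC n m → DomLE l m → QnLE (PhiHat l) (PhiHat m)) := by
  refine ⟨fun a ha => ?_, fun l hl => ?_, fun a ha => ?_, fun l hl => ?_, fun a b ha hb h => ?_,
    fun l m hl hm h => ?_⟩
  · obtain ⟨hq, rfl⟩ := (inQnC_iff_weave n a).1 ha
    rw [PhiC_eq_collapse hq.succ_le]
    exact inPC_collapse hq
  · rw [inQnC_iff_weave, weave_PhiHat]
    exact ⟨isQuasiPartition_hatSeq hl, psum_hatSeq hl⟩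
  · have hq := ((inQnC_iff_weave n a).1 ha).1
    apply weave_injective
    rw [weave_PhiHat, PhiC_eq_collapse hq.succ_le, hatSeq_collapse hq]
  · have hq := (isQuasiPartition_hatSeq hl).succ_le
    rw [← weave_PhiHat] at hq
    rw [PhiC_eq_collapse hq, weave_PhiHat, collapse_hatSeq hl]
  · have hqa := ((inQnC_iff_weave n a).1 ha).1
    have hqb := ((inQnC_iff_weave n b).1 hb).1
    rw [PhiC_eq_collapse hqa.succ_le, PhiC_eq_collapse hqb.succ_le]
    exact domLE_collapse hqa hqb ((qnLE_iff_weave a b).1 h)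
  · rw [qnLE_iff_weave, weave_PhiHat, weave_PhiHat]
    exact domLE_hatSeq hl hm h

end
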